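/- arXiv:1407.6848 — 2 statements merged into one kernel-verified Lean document; each statement's English description precedes it below -/
import Mathlib

section
/- Let F be a cumulative distribution function on ℝ with finite mean μ. Define u(s) = (μ − F^{-1}(A(s)))/(F^{-1}(B(s)) − F^{-1}(A(s))) for s ∈ (c,0) and u(c) = 1/2. Let Y be a random variable with distribution K and U a uniform random variable on [0,1] independent of Y, and set X = A(Y)·1_{U ≥ u(Y)} + B(Y)·1_{U < u(Y)}. Then F^{-1}(X) has distribution F. -/
open MeasureTheory ProbabilityTheory Set Filter Topology Asymptotics

noncomputable section

/-- Generalized inverse `F⁻¹` of the CDF of the distribution `ν`: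
`F⁻¹(t) = inf {x | F(x) ≥ t}` for `t ≠ 0` and `F⁻¹(0) = inf {x | F(x) > 0}`. -/
def qf (ν : Measure ℝ) (t : ℝ) : ℝ :=
  if t = 0 then sInf {x : ℝ | 0 < (ν (Iic x)).toReal}
  else sInf {x : ℝ | t ≤ (ν (Iic x)).toReal}

/-- `H(s) = ∫₀ˢ (F⁻¹(t) − μ) dt`. -/
def Hfun (ν : Measure ℝ) (μ : ℝ) (s : ℝ) : ℝ := ∫ t in (0:ℝ)..s, (qf ν t - μ)

/-- `ν = F(μ−)`. -/
def nuM (ν : Measure ℝ) (μ : ℝ) : ℝ := (ν (Iio μ)).toReal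

/-- `ν⁺ = F(μ)`. -/
def nuP (ν : Measure ℝ) (μ : ℝ) : ℝ := (ν (Iic μ)).toReal

/-- `c = H(ν)`, the minimum value of `H`. -/
def cval (ν : Measure ℝ) (μ : ℝ) : ℝ := Hfun ν μ (nuM ν μ)

/-- `A : [c,0] → [0,ν]`, the inverse of `H` on `[0,ν)`, with `A(c) = ν⁺`. -/
def Afun (ν : Measure ℝ) (μ : ℝ) (s : ℝ) : ℝ :=
  if s = cval ν μ then nuP ν μ
  else sInf {t : ℝ | t ∈ Icc 0 (nuM ν μ) ∧ Hfun ν μ t ≤ s}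

/-- `B : [c,0] → [ν⁺,1]`, the inverse of `H` on `(ν⁺,1]`, with `B(c) = ν⁺`. -/
def Bfun (ν : Measure ℝ) (μ : ℝ) (s : ℝ) : ℝ :=
  if s = cval ν μ then nuP ν μ
  else sInf {t : ℝ | t ∈ Icc (nuP ν μ) 1 ∧ s ≤ Hfun ν μ t}

/-- The distribution function `K`, supported on `[c,0]`. -/
def Kfun (ν : Measure ℝ) (μ : ℝ) (s : ℝ) : ℝ :=
  if 0 < s then 1
  else if s < cval ν μ then 0
  else if s = cval ν μ then nuP ν μ - nuM ν μ
  else Bfun ν μ s - Afun ν μ s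

/-- `u(s) = (μ − F⁻¹(A(s))) / (F⁻¹(B(s)) − F⁻¹(A(s)))` for `s ∈ (c,0)`, `u(c) = 1/2`. -/
def ufun (ν : Measure ℝ) (μ : ℝ) (s : ℝ) : ℝ :=
  if s = cval ν μ then 1/2
  else (μ - qf ν (Afun ν μ s)) / (qf ν (Bfun ν μ s) - qf ν (Afun ν μ s))

/-- Generalized inverse of the distribution function `K`. -/
def Kinv (ν : Measure ℝ) (μ : ℝ) (t : ℝ) : ℝ := sInf {s : ℝ | t ≤ Kfun ν μ s}

/-- The map `t ↦ F⁻¹(B(Y(t))) − F⁻¹(A(Y(t)))` where `Y = K⁻¹` is the quantile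
transform of `K`; applied to a uniform random variable it realizes the residual
distribution of `F`. -/
def residualRV (ν : Measure ℝ) (μ : ℝ) (t : ℝ) : ℝ :=
  qf ν (Bfun ν μ (Kinv ν μ t)) - qf ν (Afun ν μ (Kinv ν μ t))

/-- The residual distribution `F̃` of `F`: the law of `F⁻¹(B(Y)) − F⁻¹(A(Y))`
for `Y ∼ K`. -/
def residualDist (ν : Measure ℝ) (μ : ℝ) : Measure ℝ :=
  Measure.map (residualRV ν μ) (volume.restrict (Icc (0:ℝ) 1))

end

section Quantile

variable (ν : Measure ℝ) [IsProbabilityMeasure ν] {t : ℝ}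

lemma qf_eq_sInf_cdf (ht : t ≠ 0) : qf ν t = sInf {x | t ≤ cdf ν x} := by
  simp only [qf, if_neg ht, cdf_eq_real, measureReal_def]

lemma qf_le_iff (ht : t ∈ Ioo (0 : ℝ) 1) {x : ℝ} : qf ν t ≤ x ↔ t ≤ cdf ν x := by
  rw [qf_eq_sInf_cdf ν ht.1.ne']
  have hne : {x | t ≤ cdf ν x}.Nonempty :=
    (((tendsto_cdf_atTop ν).eventually (lt_mem_nhds ht.2)).exists).imp fun _ h => h.le
  have hbdd : BddBelow {x | t ≤ cdf ν x} := by
    obtain ⟨y, hy⟩ := ((tendsto_cdf_atBot ν).eventually (gt_mem_nhds ht.1)).exists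
    refine ⟨y, fun x hx => ?_⟩
    by_contra! hlt
    exact absurd (hx.trans (monotone_cdf ν hlt.le)) (not_le.2 hy)
  refine ⟨fun h => ?_, fun h => csInf_le hbdd h⟩
  have hright : Tendsto (cdf ν) (𝓝[>] x) (𝓝 (cdf ν x)) :=
    ((cdf ν).right_continuous x).tendsto.mono_left (nhdsWithin_mono _ Ioi_subset_Ici_self)
  refine ge_of_tendsto hright ?_
  filter_upwards [self_mem_nhdsWithin] with y hy
  obtain ⟨z, hz, hzy⟩ := exists_lt_of_csInf_lt hne (h.trans_lt hy)
  exact le_trans hz (monotone_cdf ν hzy.le)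

lemma qf_of_neg (ht : t < 0) : qf ν t = 0 := by
  rw [qf_eq_sInf_cdf ν ht.ne]
  have : {x | t ≤ cdf ν x} = univ := by
    ext x; simpa using ht.le.trans (cdf_nonneg ν x)
  simp [this]

lemma qf_of_one_lt (ht : 1 < t) : qf ν t = 0 := by
  rw [qf_eq_sInf_cdf ν (by linarith)]
  have : {x | t ≤ cdf ν x} = ∅ := by
    ext x; simpa using (cdf_le_one ν x).trans_lt ht
  simp [this]

lemma measurable_indicator_qf : Measurable ((Ioo (0 : ℝ) 1).indicator (qf ν)) := by
  refine measurable_of_Iic fun x => ?_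
  have : (Ioo (0 : ℝ) 1).indicator (qf ν) ⁻¹' Iic x =
      (Ioo 0 1 ∩ Iic (cdf ν x)) ∪ ((Ioo 0 1)ᶜ ∩ {_t | 0 ≤ x}) := by
    ext t
    by_cases ht : t ∈ Ioo (0 : ℝ) 1
    · simp [ht, qf_le_iff ν ht]
    · simp only [mem_preimage, indicator_of_notMem ht, mem_Iic, mem_union, mem_inter_iff, ht,
        false_and, mem_compl_iff, not_false_eq_true, true_and, mem_ofPred_eq, false_or]
  rw [this]
  exact (measurableSet_Ioo.inter measurableSet_Iic).union
    (measurableSet_Ioo.compl.inter (MeasurableSet.const _))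

lemma qf_eq_ite_indicator (t : ℝ) : qf ν t =
    if t = 0 then qf ν 0 else if t = 1 then qf ν 1 else (Ioo (0 : ℝ) 1).indicator (qf ν) t := by
  split_ifs with h0 h1
  · rw [h0]
  · rw [h1]
  · rcases lt_or_gt_of_ne h0 with h | h
    · rw [qf_of_neg ν h, indicator_of_notMem fun h' => absurd h'.1 h.not_gt]
    rcases lt_or_gt_of_ne h1 with h' | h'
    · rw [indicator_of_mem (show t ∈ Ioo (0 : ℝ) 1 from ⟨h, h'⟩)]
    · rw [qf_of_one_lt ν h', indicator_of_notMem fun h'' => absurd h''.2 h'.not_gt]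

lemma measurable_qf : Measurable (qf ν) := by
  rw [show qf ν = _ from funext (qf_eq_ite_indicator ν)]
  exact Measurable.ite (measurableSet_singleton 0) measurable_const
    (Measurable.ite (measurableSet_singleton 1) measurable_const (measurable_indicator_qf ν))

lemma qf_ae_eq_indicator : qf ν =ᵐ[volume] (Ioo (0 : ℝ) 1).indicator (qf ν) := by
  filter_upwards [compl_mem_ae_iff.2 (measure_singleton (μ := volume) (0 : ℝ)),
    compl_mem_ae_iff.2 (measure_singleton (μ := volume) (1 : ℝ))] with t h0 h1
  exact (qf_eq_ite_indicator ν t).trans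
    (by rw [if_neg (show ¬t = 0 from h0), if_neg (show ¬t = 1 from h1)])

/-- The quantile transform of a uniform random variable has the original law. -/
lemma map_qf_restrict_Ioo : Measure.map (qf ν) (volume.restrict (Ioo 0 1)) = ν := by
  refine (Measure.ext_of_Iic _ _ fun x => ?_).symm
  rw [Measure.map_apply (measurable_qf ν) measurableSet_Iic,
    Measure.restrict_apply ((measurable_qf ν) measurableSet_Iic)]
  have : qf ν ⁻¹' Iic x ∩ Ioo 0 1 = Iic (cdf ν x) ∩ Ioo 0 1 := by
    ext t
    simp only [mem_inter_iff, mem_preimage, mem_Iic]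
    exact and_congr_left fun ht => qf_le_iff ν ht
  rw [this, ← ofReal_cdf ν x]
  have h : (Iic (cdf ν x) ∩ Ioo 0 1 : Set ℝ) =ᵐ[volume] (Iic (cdf ν x) ∩ Ioc 0 1 : Set ℝ) :=
    EventuallyEq.rfl.inter Ioo_ae_eq_Ioc
  have h' : (Iic (cdf ν x) ∩ Ioc 0 1 : Set ℝ) = Ioc 0 (cdf ν x) := by
    ext t
    have := cdf_le_one ν x
    simp only [mem_inter_iff, mem_Iic, mem_Ioc]
    exact ⟨fun h => ⟨h.2.1, h.1⟩, fun h => ⟨h.2, h.1, h.2.trans this⟩⟩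
  rw [measure_congr h, h', Real.volume_Ioc, sub_zero]

variable {ν}

lemma integrable_qf (hint : Integrable id ν) : Integrable (qf ν) volume := by
  refine Integrable.congr ?_ (qf_ae_eq_indicator ν).symm
  rw [integrable_indicator_iff measurableSet_Ioo]
  rw [← map_qf_restrict_Ioo ν] at hint
  exact (integrable_map_measure aestronglyMeasurable_id (measurable_qf ν).aemeasurable).1 hint

lemma intervalIntegral_qf : ∫ t in (0 : ℝ)..1, qf ν t = ∫ x, x ∂ν := by
  conv_rhs => rw [← map_qf_restrict_Ioo ν]
  rw [integral_map (measurable_qf ν).aemeasurable (by fun_prop),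
    intervalIntegral.integral_of_le zero_le_one, integral_Ioc_eq_integral_Ioo]

end Quantile

section Primitive

variable {ν : Measure ℝ} {μ : ℝ}

lemma nuM_nonneg : 0 ≤ nuM ν μ := ENNReal.toReal_nonneg

@[simp] lemma Hfun_zero : Hfun ν μ 0 = 0 := intervalIntegral.integral_same

variable [IsProbabilityMeasure ν]

lemma nuP_le_one : nuP ν μ ≤ 1 := measureReal_le_one

lemma nuM_le_nuP : nuM ν μ ≤ nuP ν μ := measureReal_mono (μ := ν) Iio_subset_Iic_self

lemma nuP_eq_cdf : nuP ν μ = cdf ν μ := (cdf_eq_real ν μ).symm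

lemma nuM_eq_leftLim_cdf : nuM ν μ = Function.leftLim (cdf ν) μ := by
  have h := (cdf ν).measure_Iio (tendsto_cdf_atBot ν) μ
  rw [measure_cdf, sub_zero] at h
  rw [nuM, h, ENNReal.toReal_ofReal]
  exact (cdf_nonneg ν (μ - 1)).trans ((monotone_cdf ν).le_leftLim (by linarith))

lemma cdf_le_nuM {x : ℝ} (hx : x < μ) : cdf ν x ≤ nuM ν μ :=
  nuM_eq_leftLim_cdf (ν := ν) ▸ (monotone_cdf ν).le_leftLim hx

lemma qf_lt_of_lt_nuM {t : ℝ} (ht : t ∈ Ioo 0 (nuM ν μ)) : qf ν t < μ := by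
  have ht1 : t ∈ Ioo (0 : ℝ) 1 :=
    ⟨ht.1, ht.2.trans_le (nuM_le_nuP.trans nuP_le_one)⟩
  rw [nuM_eq_leftLim_cdf] at ht
  obtain ⟨x, hx, hxμ⟩ := (((monotone_cdf ν).tendsto_leftLim μ).eventually
    (lt_mem_nhds ht.2) |>.and self_mem_nhdsWithin).exists
  exact ((qf_le_iff ν ht1).2 hx.le).trans_lt hxμ

lemma lt_qf_of_nuP_lt {t : ℝ} (ht : t ∈ Ioo (nuP ν μ) 1) : μ < qf ν t := by
  have ht1 : t ∈ Ioo (0 : ℝ) 1 := ⟨(nuM_nonneg.trans nuM_le_nuP).trans_lt ht.1, ht.2⟩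
  rw [← not_le, qf_le_iff ν ht1, ← nuP_eq_cdf, not_le]
  exact ht.1

lemma qf_eq_of_mem_Ioc {t : ℝ} (ht : t ∈ Ioc (nuM ν μ) (nuP ν μ)) : qf ν t = μ := by
  rw [qf_eq_sInf_cdf ν (nuM_nonneg.trans_lt ht.1).ne']
  refine IsLeast.csInf_eq ⟨show t ≤ cdf ν μ from ht.2.trans_eq nuP_eq_cdf, fun x hx => ?_⟩
  by_contra! h
  exact absurd (hx.trans (cdf_le_nuM h)) (not_le.2 ht.1)

lemma intervalIntegrable_qf_sub (hint : Integrable id ν) (a b : ℝ) :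
    IntervalIntegrable (fun t => qf ν t - μ) volume a b :=
  (integrable_qf hint).intervalIntegrable.sub intervalIntegrable_const

lemma continuous_Hfun (hint : Integrable id ν) : Continuous (Hfun ν μ) :=
  intervalIntegral.continuous_primitive (intervalIntegrable_qf_sub hint) 0

lemma Hfun_sub (hint : Integrable id ν) (a b : ℝ) :
    Hfun ν μ b - Hfun ν μ a = ∫ t in a..b, (qf ν t - μ) :=
  intervalIntegral.integral_interval_sub_left (intervalIntegrable_qf_sub hint _ _)
    (intervalIntegrable_qf_sub hint _ _)

lemma Hfun_one (hint : Integrable id ν) (hμ : μ = ∫ x, x ∂ν) : Hfun ν μ 1 = 0 := by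
  rw [Hfun, intervalIntegral.integral_sub (integrable_qf hint).intervalIntegrable
    intervalIntegrable_const, intervalIntegral_qf, ← hμ]
  simp

lemma strictAntiOn_Hfun (hint : Integrable id ν) :
    StrictAntiOn (Hfun ν μ) (Icc 0 (nuM ν μ)) := by
  intro a ha b hb hab
  rw [← sub_pos, Hfun_sub hint, intervalIntegral.integral_symm, ← intervalIntegral.integral_neg]
  refine intervalIntegral.intervalIntegral_pos_of_pos_on
    (intervalIntegrable_qf_sub hint _ _).neg (fun t ht => ?_) hab
  have := qf_lt_of_lt_nuM (ν := ν) (μ := μ) ⟨ha.1.trans_lt ht.1, ht.2.trans_le hb.2⟩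
  linarith

lemma strictMonoOn_Hfun (hint : Integrable id ν) :
    StrictMonoOn (Hfun ν μ) (Icc (nuP ν μ) 1) := by
  intro a ha b hb hab
  rw [← sub_pos, Hfun_sub hint]
  refine intervalIntegral.intervalIntegral_pos_of_pos_on
    (intervalIntegrable_qf_sub hint _ _) (fun t ht => ?_) hab
  have := lt_qf_of_nuP_lt (ν := ν) (μ := μ) ⟨ha.1.trans_lt ht.1, ht.2.trans_le hb.2⟩
  linarith

lemma Hfun_eq_cval (hint : Integrable id ν) {t : ℝ} (ht : t ∈ Icc (nuM ν μ) (nuP ν μ)) :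
    Hfun ν μ t = cval ν μ := by
  rw [← sub_eq_zero, cval, Hfun_sub hint, intervalIntegral.integral_of_le ht.1]
  refine setIntegral_eq_zero_of_forall_eq_zero fun x hx => ?_
  rw [qf_eq_of_mem_Ioc ⟨hx.1, hx.2.trans ht.2⟩, sub_self]

end Primitive

section Inverse

variable {ν : Measure ℝ} [IsProbabilityMeasure ν] {μ : ℝ}

lemma cval_le_Hfun (hint : Integrable id ν) {t : ℝ} (ht : t ∈ Icc (0 : ℝ) 1) :
    cval ν μ ≤ Hfun ν μ t := by
  rcases le_total t (nuM ν μ) with h | h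
  · exact (strictAntiOn_Hfun hint).antitoneOn ⟨ht.1, h⟩ ⟨nuM_nonneg, le_rfl⟩ h
  rcases le_total t (nuP ν μ) with h' | h'
  · exact (Hfun_eq_cval hint ⟨h, h'⟩).ge
  · rw [← Hfun_eq_cval hint ⟨nuM_le_nuP, le_rfl⟩]
    exact (strictMonoOn_Hfun hint).monotoneOn ⟨le_rfl, nuP_le_one⟩ ⟨h', ht.2⟩ h'

lemma Hfun_nonpos (hint : Integrable id ν) (hμ : μ = ∫ x, x ∂ν) {t : ℝ}
    (ht : t ∈ Icc (0 : ℝ) 1) : Hfun ν μ t ≤ 0 := by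
  have hanti {t : ℝ} (ht : t ∈ Icc 0 (nuM ν μ)) : Hfun ν μ t ≤ 0 :=
    ((strictAntiOn_Hfun hint).antitoneOn ⟨le_rfl, nuM_nonneg⟩ ht ht.1).trans_eq Hfun_zero
  rcases le_total t (nuM ν μ) with h | h
  · exact hanti ⟨ht.1, h⟩
  rcases le_total t (nuP ν μ) with h' | h'
  · exact (Hfun_eq_cval hint ⟨h, h'⟩).trans_le (hanti ⟨nuM_nonneg, le_rfl⟩)
  · exact ((strictMonoOn_Hfun hint).monotoneOn ⟨h', ht.2⟩ ⟨nuP_le_one, le_rfl⟩ ht.2).trans_eq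
      (Hfun_one hint hμ)

lemma Hfun_nuP (hint : Integrable id ν) : Hfun ν μ (nuP ν μ) = cval ν μ :=
  Hfun_eq_cval hint ⟨nuM_le_nuP, le_rfl⟩

lemma Afun_Hfun (hint : Integrable id ν) {t : ℝ} (ht : t ∈ Ico 0 (nuM ν μ)) :
    Afun ν μ (Hfun ν μ t) = t := by
  have hH := strictAntiOn_Hfun (μ := μ) hint
  have hlt : cval ν μ < Hfun ν μ t := hH (Ico_subset_Icc_self ht) ⟨nuM_nonneg, le_rfl⟩ ht.2
  rw [Afun, if_neg hlt.ne']
  exact IsLeast.csInf_eq ⟨⟨Ico_subset_Icc_self ht, le_rfl⟩, fun x hx =>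
    (hH.le_iff_ge hx.1 (Ico_subset_Icc_self ht)).1 hx.2⟩

lemma Bfun_Hfun (hint : Integrable id ν) {t : ℝ} (ht : t ∈ Ioc (nuP ν μ) 1) :
    Bfun ν μ (Hfun ν μ t) = t := by
  have hH := strictMonoOn_Hfun (μ := μ) hint
  have hlt : cval ν μ < Hfun ν μ t :=
    (Hfun_nuP hint).symm.trans_lt (hH ⟨le_rfl, nuP_le_one⟩ (Ioc_subset_Icc_self ht) ht.1)
  rw [Bfun, if_neg hlt.ne']
  exact IsLeast.csInf_eq ⟨⟨Ioc_subset_Icc_self ht, le_rfl⟩, fun x hx =>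
    (hH.le_iff_le (Ioc_subset_Icc_self ht) hx.1).1 hx.2⟩

lemma exists_Hfun_eq_left (hint : Integrable id ν) {s : ℝ} (hs : s ∈ Ioc (cval ν μ) 0) :
    ∃ t ∈ Ico 0 (nuM ν μ), Hfun ν μ t = s := by
  obtain ⟨t, ht, rfl⟩ := intermediate_value_Icc' nuM_nonneg (continuous_Hfun hint).continuousOn
    (show s ∈ Icc (Hfun ν μ (nuM ν μ)) (Hfun ν μ 0) from ⟨hs.1.le, by simpa using hs.2⟩)
  refine ⟨t, ⟨ht.1, ht.2.lt_of_ne fun h => hs.1.ne ?_⟩, rfl⟩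
  rw [h, cval]

lemma exists_Hfun_eq_right (hint : Integrable id ν) (hμ : μ = ∫ x, x ∂ν) {s : ℝ}
    (hs : s ∈ Ioc (cval ν μ) 0) : ∃ t ∈ Ioc (nuP ν μ) 1, Hfun ν μ t = s := by
  obtain ⟨t, ht, rfl⟩ := intermediate_value_Icc nuP_le_one (continuous_Hfun hint).continuousOn
    (show s ∈ Icc (Hfun ν μ (nuP ν μ)) (Hfun ν μ 1) by
      rw [Hfun_nuP hint, Hfun_one hint hμ]; exact Ioc_subset_Icc_self hs)
  refine ⟨t, ⟨ht.1.lt_of_ne fun h => hs.1.ne ?_, ht.2⟩, rfl⟩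
  rw [← h, Hfun_nuP hint]

lemma measurable_Afun (hint : Integrable id ν) : Measurable (Afun ν μ) := by
  have hanti : Antitone fun s =>
      sInf {t : ℝ | t ∈ Icc 0 (nuM ν μ) ∧ (Hfun ν μ t ≤ s ∨ t = nuM ν μ)} := fun s s' h =>
    csInf_le_csInf ⟨0, fun t ht => ht.1.1⟩ ⟨nuM ν μ, ⟨nuM_nonneg, le_rfl⟩, Or.inr rfl⟩
      fun t ht => ⟨ht.1, ht.2.imp_left fun h' => h'.trans h⟩
  have hA : Afun ν μ = fun s => if s = cval ν μ then nuP ν μ else if s < cval ν μ then 0 else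
      sInf {t : ℝ | t ∈ Icc 0 (nuM ν μ) ∧ (Hfun ν μ t ≤ s ∨ t = nuM ν μ)} := by
    ext s
    rw [Afun]
    split_ifs with h h'
    · rfl
    · convert Real.sInf_empty
      refine eq_empty_of_forall_notMem fun t ht => ?_
      have := cval_le_Hfun (μ := μ) hint ⟨ht.1.1, ht.1.2.trans (nuM_le_nuP.trans nuP_le_one)⟩
      linarith [ht.2]
    · congr 1
      ext t
      refine and_congr_right fun _ => ⟨Or.inl, fun ht => ht.elim id ?_⟩
      rintro rfl
      exact not_lt.1 h'
  rw [hA]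
  exact Measurable.ite (measurableSet_singleton _) measurable_const
    (Measurable.ite measurableSet_Iio measurable_const hanti.measurable)

lemma measurable_Bfun (hint : Integrable id ν) (hμ : μ = ∫ x, x ∂ν) :
    Measurable (Bfun ν μ) := by
  have hmono : Monotone fun s =>
      sInf {t : ℝ | t ∈ Icc (nuP ν μ) 1 ∧ (s ≤ Hfun ν μ t ∨ t = 1)} := fun s s' h =>
    csInf_le_csInf ⟨nuP ν μ, fun t ht => ht.1.1⟩ ⟨1, ⟨nuP_le_one, le_rfl⟩, Or.inr rfl⟩
      fun t ht => ⟨ht.1, ht.2.imp_left fun h' => h.trans h'⟩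
  have hB : Bfun ν μ = fun s => if s = cval ν μ then nuP ν μ else if 0 < s then 0 else
      sInf {t : ℝ | t ∈ Icc (nuP ν μ) 1 ∧ (s ≤ Hfun ν μ t ∨ t = 1)} := by
    ext s
    rw [Bfun]
    split_ifs with h h'
    · rfl
    · convert Real.sInf_empty
      refine eq_empty_of_forall_notMem fun t ht => ?_
      have := Hfun_nonpos hint hμ ⟨(nuM_nonneg.trans nuM_le_nuP).trans ht.1.1, ht.1.2⟩
      linarith [ht.2]
    · congr 1
      ext t
      refine and_congr_right fun _ => ⟨Or.inl, fun ht => ht.elim id ?_⟩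
      rintro rfl
      exact (Hfun_one hint hμ).symm ▸ not_lt.1 h'
  rw [hB]
  exact Measurable.ite (measurableSet_singleton _) measurable_const
    (Measurable.ite measurableSet_Ioi measurable_const hmono.measurable)

lemma measurable_ufun (hint : Integrable id ν) (hμ : μ = ∫ x, x ∂ν) :
    Measurable (ufun ν μ) := by
  have hA := (measurable_qf ν).comp (measurable_Afun (μ := μ) hint)
  have hB := (measurable_qf ν).comp (measurable_Bfun hint hμ)
  exact Measurable.ite (measurableSet_singleton _) measurable_const
    ((measurable_const.sub hA).div (hB.sub hA))

lemma Hfun_preimage_Iic_inter_Icc (hint : Integrable id ν) (hμ : μ = ∫ x, x ∂ν) {s : ℝ}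
    (hs : s ∈ Ioc (cval ν μ) 0) :
    Hfun ν μ ⁻¹' Iic s ∩ Icc 0 1 = Icc (Afun ν μ s) (Bfun ν μ s) := by
  have hanti := strictAntiOn_Hfun (μ := μ) hint
  have hmono := strictMonoOn_Hfun (μ := μ) hint
  obtain ⟨a, ha, has⟩ := exists_Hfun_eq_left hint hs
  obtain ⟨b, hb, hbs⟩ := exists_Hfun_eq_right hint hμ hs
  rw [← has, Afun_Hfun hint ha, has, ← hbs, Bfun_Hfun hint hb, hbs]
  have hMP := nuM_le_nuP (ν := ν) (μ := μ)
  ext t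
  simp only [mem_inter_iff, mem_preimage, mem_Iic, mem_Icc]
  refine ⟨fun ⟨ht, ht0, ht1⟩ => ⟨?_, ?_⟩,
    fun ⟨hat, htb⟩ => ⟨?_, ha.1.trans hat, htb.trans hb.2⟩⟩
  · by_contra! h
    exact (hanti ⟨ht0, (h.trans ha.2).le⟩ (Ico_subset_Icc_self ha) h).not_ge (ht.trans_eq has.symm)
  · by_contra! h
    exact (hmono (Ioc_subset_Icc_self hb) ⟨(hb.1.trans h).le, ht1⟩ h).not_ge (ht.trans_eq hbs.symm)
  · rcases le_total t (nuM ν μ) with h | h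
    · exact has ▸ hanti.antitoneOn (Ico_subset_Icc_self ha) ⟨ha.1.trans hat, h⟩ hat
    rcases le_total t (nuP ν μ) with h' | h'
    · exact (Hfun_eq_cval hint ⟨h, h'⟩).trans_le hs.1.le
    · exact hbs ▸ hmono.monotoneOn ⟨h', htb.trans hb.2⟩ (Ioc_subset_Icc_self hb) htb

lemma Hfun_preimage_Iic_cval_inter_Icc (hint : Integrable id ν) :
    Hfun ν μ ⁻¹' Iic (cval ν μ) ∩ Icc 0 1 = Icc (nuM ν μ) (nuP ν μ) := by
  have hMP := nuM_le_nuP (ν := ν) (μ := μ)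
  ext t
  simp only [mem_inter_iff, mem_preimage, mem_Iic, mem_Icc]
  refine ⟨fun ⟨ht, ht0, ht1⟩ => ⟨?_, ?_⟩, fun ht => ⟨(Hfun_eq_cval hint ht).le,
    nuM_nonneg.trans ht.1, ht.2.trans nuP_le_one⟩⟩
  · by_contra! h
    exact (strictAntiOn_Hfun hint ⟨ht0, h.le⟩ ⟨nuM_nonneg, le_rfl⟩ h).not_ge ht
  · by_contra! h
    exact (strictMonoOn_Hfun hint ⟨le_rfl, nuP_le_one⟩ ⟨h.le, ht1⟩ h).not_ge
      (ht.trans_eq (Hfun_nuP hint).symm)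

lemma cval_nonpos (hint : Integrable id ν) (hμ : μ = ∫ x, x ∂ν) : cval ν μ ≤ 0 :=
  Hfun_nonpos hint hμ ⟨nuM_nonneg, nuM_le_nuP.trans nuP_le_one⟩

/-- `K` is the distribution function of `H(V)` for `V` uniform on `[0,1]`. -/
lemma volume_Hfun_le (hint : Integrable id ν) (hμ : μ = ∫ x, x ∂ν) (s : ℝ) :
    volume (Hfun ν μ ⁻¹' Iic s ∩ Icc 0 1) = ENNReal.ofReal (Kfun ν μ s) := by
  have hc := cval_nonpos hint hμ
  rw [Kfun]
  split_ifs with h0 h1 h2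
  · have : Hfun ν μ ⁻¹' Iic s ∩ Icc 0 1 = Icc 0 1 :=
      inter_eq_right.2 fun t ht => (Hfun_nonpos hint hμ ht).trans h0.le
    simp [this]
  · have : Hfun ν μ ⁻¹' Iic s ∩ Icc 0 1 = ∅ :=
      eq_empty_of_forall_notMem fun t ht => (h1.trans_le (cval_le_Hfun hint ht.2)).not_ge ht.1
    simp [this]
  · rw [h2, Hfun_preimage_Iic_cval_inter_Icc hint, Real.volume_Icc]
  · rw [Hfun_preimage_Iic_inter_Icc hint hμ ⟨(not_lt.1 h1).lt_of_ne' h2, not_lt.1 h0⟩,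
      Real.volume_Icc]

lemma map_Hfun_eq (hint : Integrable id ν) (hμ : μ = ∫ x, x ∂ν) {κ : Measure ℝ}
    [IsFiniteMeasure κ] (hκ : ∀ s, (κ (Iic s)).toReal = Kfun ν μ s) :
    κ = Measure.map (Hfun ν μ) (volume.restrict (Icc 0 1)) := by
  refine Measure.ext_of_Iic _ _ fun s => ?_
  have hm := (continuous_Hfun (μ := μ) hint).measurable
  rw [Measure.map_apply hm measurableSet_Iic, Measure.restrict_apply (hm measurableSet_Iic),
    volume_Hfun_le hint hμ, ← hκ, ENNReal.ofReal_toReal (measure_ne_top _ _)]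

end Inverse

section ChangeOfVariables

open scoped ENNReal

/-- If `φ` is the density of the increments of the continuous strictly increasing function `G`
on `[a, b]`, then `G` pushes `φ(t) dt` forward to Lebesgue measure on `(G a, G b]`. -/
lemma map_withDensity_eq_restrict_Ioc {G : ℝ → ℝ} {φ : ℝ → ℝ≥0∞} {a b : ℝ} (hab : a ≤ b)
    (hG : Continuous G) (hmono : StrictMonoOn G (Icc a b))
    (hφ : ∀ x ∈ Icc a b, ∫⁻ t in Ioc a x, φ t = ENNReal.ofReal (G x - G a)) :
    Measure.map G ((volume.restrict (Ioc a b)).withDensity φ) =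
      volume.restrict (Ioc (G a) (G b)) := by
  refine (Measure.ext_of_Iic _ _ fun s => ?_).symm
  have hm : MeasurableSet (G ⁻¹' Iic s) := hG.measurable measurableSet_Iic
  rw [Measure.map_apply hG.measurable measurableSet_Iic, withDensity_apply _ hm,
    Measure.restrict_restrict hm, Measure.restrict_apply measurableSet_Iic]
  suffices ∃ x ∈ Icc a b, G ⁻¹' Iic s ∩ Ioc a b = Ioc a x ∧
      Iic s ∩ Ioc (G a) (G b) = Ioc (G a) (G x) by
    obtain ⟨x, hx, h1, h2⟩ := this
    rw [h1, h2, hφ x hx, Real.volume_Ioc]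
  rcases lt_or_ge s (G a) with hsa | hsa
  · refine ⟨a, ⟨le_rfl, hab⟩, ?_, ?_⟩
    · rw [Ioc_self]
      refine eq_empty_of_forall_notMem fun t ht => hsa.not_ge ?_
      exact (hmono.monotoneOn ⟨le_rfl, hab⟩ (Ioc_subset_Icc_self ht.2) ht.2.1.le).trans ht.1
    · rw [Ioc_self]
      exact eq_empty_of_forall_notMem fun t ht => (ht.2.1.trans_le ht.1).not_gt hsa
  rcases lt_or_ge (G b) s with hsb | hsb
  · refine ⟨b, ⟨hab, le_rfl⟩, inter_eq_right.2 fun t ht => ?_,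
      inter_eq_right.2 fun t ht => ht.2.trans hsb.le⟩
    exact (hmono.monotoneOn (Ioc_subset_Icc_self ht) ⟨hab, le_rfl⟩ ht.2).trans hsb.le
  obtain ⟨x, hx, rfl⟩ := intermediate_value_Icc hab hG.continuousOn ⟨hsa, hsb⟩
  refine ⟨x, hx, ?_, ?_⟩
  · ext t
    simp only [mem_inter_iff, mem_preimage, mem_Iic, mem_Ioc]
    exact ⟨fun h => ⟨h.2.1, (hmono.le_iff_le (Ioc_subset_Icc_self h.2) hx).1 h.1⟩,
      fun h => ⟨hmono.monotoneOn ⟨h.1.le, h.2.trans hx.2⟩ hx h.2, h.1, h.2.trans hx.2⟩⟩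
  · ext t
    simp only [mem_inter_iff, mem_Iic, mem_Ioc]
    exact ⟨fun h => ⟨h.2.1, h.1⟩, fun h => ⟨h.2, h.1, h.2.trans hsb⟩⟩

lemma lintegral_comp_mul_of_strictMonoOn {G : ℝ → ℝ} {φ f : ℝ → ℝ≥0∞} {a b : ℝ} (hab : a ≤ b)
    (hG : Continuous G) (hmono : StrictMonoOn G (Icc a b)) (hφm : Measurable φ)
    (hφ : ∀ x ∈ Icc a b, ∫⁻ t in Ioc a x, φ t = ENNReal.ofReal (G x - G a)) (hf : Measurable f) :
    ∫⁻ t in Ioo a b, φ t * f (G t) = ∫⁻ s in Ioo (G a) (G b), f s := by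
  rw [restrict_Ioo_eq_restrict_Ioc, restrict_Ioo_eq_restrict_Ioc,
    ← map_withDensity_eq_restrict_Ioc hab hG hmono hφ, lintegral_map hf hG.measurable,
    lintegral_withDensity_eq_lintegral_mul _ hφm (g := fun t => f (G t))
      (hf.comp hG.measurable)]
  rfl

variable {ν : Measure ℝ} [IsProbabilityMeasure ν] {μ : ℝ}

lemma lintegral_comp_Hfun_right (hint : Integrable id ν) (hμ : μ = ∫ x, x ∂ν) {f : ℝ → ℝ≥0∞}
    (hf : Measurable f) :
    ∫⁻ t in Ioo (nuP ν μ) 1, ENNReal.ofReal (qf ν t - μ) * f (Hfun ν μ t) =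
      ∫⁻ s in Ioo (cval ν μ) 0, f s := by
  rw [← Hfun_nuP hint, ← Hfun_one hint hμ]
  refine lintegral_comp_mul_of_strictMonoOn nuP_le_one (continuous_Hfun hint)
    (strictMonoOn_Hfun hint) ((measurable_qf ν).sub_const μ).ennreal_ofReal (fun x hx => ?_) hf
  rw [Hfun_sub hint, intervalIntegral.integral_of_le hx.1, integral_Ioc_eq_integral_Ioo,
    ofReal_integral_eq_lintegral_ofReal, restrict_Ioo_eq_restrict_Ioc]
  · rw [restrict_Ioo_eq_restrict_Ioc]
    exact (intervalIntegrable_qf_sub hint (nuP ν μ) x).1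
  · filter_upwards [ae_restrict_mem measurableSet_Ioo] with t ht
    exact (sub_pos.2 (lt_qf_of_nuP_lt ⟨ht.1, ht.2.trans_le hx.2⟩)).le

lemma lintegral_comp_Hfun_left (hint : Integrable id ν) {f : ℝ → ℝ≥0∞} (hf : Measurable f) :
    ∫⁻ t in Ioo 0 (nuM ν μ), ENNReal.ofReal (μ - qf ν t) * f (Hfun ν μ t) =
      ∫⁻ s in Ioo (cval ν μ) 0, f s := by
  have hneg : ∫⁻ s in Ioo (cval ν μ) 0, f s = ∫⁻ s in Ioo 0 (-cval ν μ), f (-s) := by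
    rw [← (Measure.measurePreserving_neg (volume : Measure ℝ)).setLIntegral_comp_preimage
      measurableSet_Ioo hf]
    simp
  have key := lintegral_comp_mul_of_strictMonoOn (G := fun t => -Hfun ν μ t)
    (φ := fun t => ENNReal.ofReal (μ - qf ν t)) (f := fun s => f (-s))
    (nuM_nonneg (ν := ν) (μ := μ)) (continuous_Hfun hint).neg
    (fun a ha b hb hab => neg_lt_neg (strictAntiOn_Hfun hint ha hb hab))
    (measurable_const.sub (measurable_qf ν)).ennreal_ofReal (fun x hx => ?_)
    (hf.comp measurable_neg)
  · rw [hneg]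
    simpa [cval] using key
  have hH : -Hfun ν μ x - -Hfun ν μ 0 = ∫ t in (0 : ℝ)..x, (μ - qf ν t) := by
    rw [← neg_sub', Hfun_sub hint, ← intervalIntegral.integral_neg]
    simp
  rw [hH, intervalIntegral.integral_of_le hx.1, integral_Ioc_eq_integral_Ioo,
    ofReal_integral_eq_lintegral_ofReal, restrict_Ioo_eq_restrict_Ioc]
  · rw [restrict_Ioo_eq_restrict_Ioc]
    exact (intervalIntegrable_const.sub (integrable_qf hint).intervalIntegrable).1
  · filter_upwards [ae_restrict_mem measurableSet_Ioo] with t ht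
    exact (sub_pos.2 (qf_lt_of_lt_nuM ⟨ht.1, ht.2.trans_le hx.2⟩)).le

end ChangeOfVariables

section Mixture

open scoped ENNReal

lemma lintegral_ite_lt {u : ℝ} (hu : u ∈ Icc (0 : ℝ) 1) (x y : ℝ≥0∞) :
    ∫⁻ v in Icc (0 : ℝ) 1, (if v < u then x else y) =
      ENNReal.ofReal u * x + ENNReal.ofReal (1 - u) * y := by
  rw [← restrict_Ico_eq_restrict_Icc, ← Ico_union_Ico_eq_Ico hu.1 hu.2,
    lintegral_union measurableSet_Ico (Ico_disjoint_Ico_same),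
    setLIntegral_congr_fun (g := fun _ => x) measurableSet_Ico fun v hv => if_pos hv.2,
    setLIntegral_congr_fun (g := fun _ => y) measurableSet_Ico fun v hv => if_neg hv.1.not_gt]
  simp [mul_comm]

lemma lintegral_Icc_split {a b : ℝ} (ha : 0 ≤ a) (hab : a ≤ b) (hb : b ≤ 1) (f : ℝ → ℝ≥0∞) :
    ∫⁻ t in Icc (0 : ℝ) 1, f t =
      (∫⁻ t in Ioo 0 a, f t) + (∫⁻ t in Ioo b 1, f t) + ∫⁻ t in Ioc a b, f t := by
  rw [← restrict_Ioc_eq_restrict_Icc, ← Ioc_union_Ioc_eq_Ioc (ha.trans hab) hb,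
    lintegral_union measurableSet_Ioc (Ioc_disjoint_Ioc_of_le le_rfl),
    ← Ioc_union_Ioc_eq_Ioc ha hab,
    lintegral_union measurableSet_Ioc (Ioc_disjoint_Ioc_of_le le_rfl),
    restrict_Ioo_eq_restrict_Ioc, restrict_Ioo_eq_restrict_Ioc, add_right_comm]

lemma inv_add_inv_mul_mixture {a m b : ℝ} (ha : a < m) (hb : m < b) (x y : ℝ≥0∞) :
    ((ENNReal.ofReal (m - a))⁻¹ + (ENNReal.ofReal (b - m))⁻¹) *
        (ENNReal.ofReal ((m - a) / (b - a)) * x + ENNReal.ofReal (1 - (m - a) / (b - a)) * y) =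
      (ENNReal.ofReal (m - a))⁻¹ * y + (ENNReal.ofReal (b - m))⁻¹ * x := by
  have h1 : 0 < m - a := sub_pos.2 ha
  have h2 : 0 < b - m := sub_pos.2 hb
  have h3 : 0 < b - a := by linarith
  have hw : 0 ≤ (m - a)⁻¹ + (b - m)⁻¹ := by positivity
  rw [← ENNReal.ofReal_inv_of_pos h1, ← ENNReal.ofReal_inv_of_pos h2,
    ← ENNReal.ofReal_add (by positivity) (by positivity), mul_add, ← mul_assoc, ← mul_assoc,
    ← ENNReal.ofReal_mul hw, ← ENNReal.ofReal_mul hw, add_comm]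
  congr 3
  · field_simp
    ring
  · field_simp
    ring

variable {ν : Measure ℝ} [IsProbabilityMeasure ν] {μ : ℝ}

lemma qf_Afun_lt (hint : Integrable id ν) {s : ℝ} (hs : s ∈ Ioo (cval ν μ) 0) :
    qf ν (Afun ν μ s) < μ := by
  obtain ⟨t, ht, rfl⟩ := exists_Hfun_eq_left hint (Ioo_subset_Ioc_self hs)
  rw [Afun_Hfun hint ht]
  refine qf_lt_of_lt_nuM ⟨ht.1.lt_of_ne' ?_, ht.2⟩
  rintro rfl
  exact hs.2.ne Hfun_zero

lemma lt_qf_Bfun (hint : Integrable id ν) (hμ : μ = ∫ x, x ∂ν) {s : ℝ}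
    (hs : s ∈ Ioo (cval ν μ) 0) : μ < qf ν (Bfun ν μ s) := by
  obtain ⟨t, ht, rfl⟩ := exists_Hfun_eq_right hint hμ (Ioo_subset_Ioc_self hs)
  rw [Bfun_Hfun hint ht]
  refine lt_qf_of_nuP_lt ⟨ht.1, ht.2.lt_of_ne ?_⟩
  rintro rfl
  exact hs.2.ne (Hfun_one hint hμ)

lemma setLIntegral_comp_Hfun_left (hint : Integrable id ν) {f : ℝ → ℝ≥0∞} (hf : Measurable f) :
    ∫⁻ t in Ioo 0 (nuM ν μ), f (Hfun ν μ t) =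
      ∫⁻ s in Ioo (cval ν μ) 0, (ENNReal.ofReal (μ - qf ν (Afun ν μ s)))⁻¹ * f s := by
  have hm := (measurable_qf ν).comp (measurable_Afun (μ := μ) hint)
  rw [← lintegral_comp_Hfun_left hint
    (f := fun s => (ENNReal.ofReal (μ - qf ν (Afun ν μ s)))⁻¹ * f s)
    ((measurable_const.sub hm).ennreal_ofReal.inv.mul hf)]
  refine setLIntegral_congr_fun measurableSet_Ioo fun t ht => ?_
  have h := qf_lt_of_lt_nuM ht
  simp only [Afun_Hfun hint (Ioo_subset_Ico_self ht)]
  rw [← mul_assoc, ENNReal.mul_inv_cancel (by simpa using h) ENNReal.ofReal_ne_top, one_mul]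

lemma setLIntegral_comp_Hfun_right (hint : Integrable id ν) (hμ : μ = ∫ x, x ∂ν)
    {f : ℝ → ℝ≥0∞} (hf : Measurable f) :
    ∫⁻ t in Ioo (nuP ν μ) 1, f (Hfun ν μ t) =
      ∫⁻ s in Ioo (cval ν μ) 0, (ENNReal.ofReal (qf ν (Bfun ν μ s) - μ))⁻¹ * f s := by
  have hm := (measurable_qf ν).comp (measurable_Bfun hint hμ)
  rw [← lintegral_comp_Hfun_right hint hμ
    (f := fun s => (ENNReal.ofReal (qf ν (Bfun ν μ s) - μ))⁻¹ * f s)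
    ((hm.sub_const μ).ennreal_ofReal.inv.mul hf)]
  refine setLIntegral_congr_fun measurableSet_Ioo fun t ht => ?_
  have h := lt_qf_of_nuP_lt ht
  simp only [Bfun_Hfun hint (Ioo_subset_Ioc_self ht)]
  rw [← mul_assoc, ENNReal.mul_inv_cancel (by simpa using h) ENNReal.ofReal_ne_top, one_mul]

lemma setLIntegral_eq_comp_Afun (hint : Integrable id ν) {f : ℝ → ℝ≥0∞} (hf : Measurable f) :
    ∫⁻ t in Ioo 0 (nuM ν μ), f t =
      ∫⁻ s in Ioo (cval ν μ) 0,
        (ENNReal.ofReal (μ - qf ν (Afun ν μ s)))⁻¹ * f (Afun ν μ s) := by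
  rw [← setLIntegral_comp_Hfun_left (f := fun s => f (Afun ν μ s)) hint
    (hf.comp (measurable_Afun hint))]
  refine setLIntegral_congr_fun measurableSet_Ioo fun t ht => ?_
  simp only [Afun_Hfun hint (Ioo_subset_Ico_self ht)]

lemma setLIntegral_eq_comp_Bfun (hint : Integrable id ν) (hμ : μ = ∫ x, x ∂ν)
    {f : ℝ → ℝ≥0∞} (hf : Measurable f) :
    ∫⁻ t in Ioo (nuP ν μ) 1, f t =
      ∫⁻ s in Ioo (cval ν μ) 0,
        (ENNReal.ofReal (qf ν (Bfun ν μ s) - μ))⁻¹ * f (Bfun ν μ s) := by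
  rw [← setLIntegral_comp_Hfun_right (f := fun s => f (Bfun ν μ s)) hint hμ
    (hf.comp (measurable_Bfun hint hμ))]
  refine setLIntegral_congr_fun measurableSet_Ioo fun t ht => ?_
  simp only [Bfun_Hfun hint (Ioo_subset_Ioc_self ht)]

lemma ufun_mem_Icc (hint : Integrable id ν) (hμ : μ = ∫ x, x ∂ν) {s : ℝ}
    (hs : s ∈ Ico (cval ν μ) 0) : ufun ν μ s ∈ Icc (0 : ℝ) 1 := by
  rw [ufun]
  split_ifs with h
  · norm_num
  have hs' : s ∈ Ioo (cval ν μ) 0 := ⟨hs.1.lt_of_ne' h, hs.2⟩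
  have h1 := qf_Afun_lt hint hs'
  have h2 := lt_qf_Bfun hint hμ hs'
  exact ⟨div_nonneg (by linarith) (by linarith), (div_le_one (by linarith)).2 (by linarith)⟩

/-- Averaging a function of `F⁻¹(X)`, first over the randomization given `Y = H(t)` and then over
`t` uniform on `[0,1]`, returns its average under the uniform quantile transform. -/
lemma lintegral_mixture_Hfun (hint : Integrable id ν) (hμ : μ = ∫ x, x ∂ν) {g : ℝ → ℝ≥0∞}
    (hg : Measurable g) {T : ℝ → ℝ≥0∞} (hTm : Measurable T)
    (hT : ∀ y, T y = ∫⁻ v in Icc (0 : ℝ) 1,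
      g (qf ν (if v < ufun ν μ y then Bfun ν μ y else Afun ν μ y))) :
    ∫⁻ t in Icc (0 : ℝ) 1, T (Hfun ν μ t) = ∫⁻ t in Icc (0 : ℝ) 1, g (qf ν t) := by
  have hgq : Measurable fun t => g (qf ν t) := hg.comp (measurable_qf ν)
  have hmid : ∫⁻ t in Ioc (nuM ν μ) (nuP ν μ), T (Hfun ν μ t) =
      ∫⁻ t in Ioc (nuM ν μ) (nuP ν μ), g (qf ν t) := by
    refine setLIntegral_congr_fun measurableSet_Ioc fun t ht => ?_
    simp only [Hfun_eq_cval hint (Ioc_subset_Icc_self ht), hT, Afun, Bfun, if_true, ite_self,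
      qf_eq_of_mem_Ioc ht,
      qf_eq_of_mem_Ioc (ν := ν) (μ := μ) ⟨ht.1.trans_le ht.2, le_rfl⟩]
    simp
  have hMP := nuM_le_nuP (ν := ν) (μ := μ)
  rw [lintegral_Icc_split nuM_nonneg hMP nuP_le_one,
    lintegral_Icc_split nuM_nonneg hMP nuP_le_one, hmid]
  congr 1
  have hmA : Measurable fun s => (ENNReal.ofReal (μ - qf ν (Afun ν μ s)))⁻¹ :=
    (measurable_const.sub ((measurable_qf ν).comp (measurable_Afun hint))).ennreal_ofReal.inv
  have hmAT : Measurable fun s => (ENNReal.ofReal (μ - qf ν (Afun ν μ s)))⁻¹ * T s :=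
    hmA.mul hTm
  have hmAg : Measurable fun s =>
      (ENNReal.ofReal (μ - qf ν (Afun ν μ s)))⁻¹ * g (qf ν (Afun ν μ s)) :=
    hmA.mul (hgq.comp (measurable_Afun hint))
  rw [setLIntegral_comp_Hfun_left hint hTm, setLIntegral_comp_Hfun_right hint hμ hTm,
    setLIntegral_eq_comp_Afun hint hgq, setLIntegral_eq_comp_Bfun hint hμ hgq,
    ← lintegral_add_left hmAT, ← lintegral_add_left hmAg]
  refine setLIntegral_congr_fun measurableSet_Ioo fun s hs => ?_
  have hTs : T s = ENNReal.ofReal (ufun ν μ s) * g (qf ν (Bfun ν μ s)) +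
      ENNReal.ofReal (1 - ufun ν μ s) * g (qf ν (Afun ν μ s)) := by
    rw [hT, ← lintegral_ite_lt (ufun_mem_Icc hint hμ (Ioo_subset_Ico_self hs))]
    simp only [apply_ite (qf ν), apply_ite g]
  simp only [hTs, ← add_mul]
  rw [ufun, if_neg hs.1.ne']
  exact inv_add_inv_mul_mixture (qf_Afun_lt hint hs) (lt_qf_Bfun hint hμ hs) _ _

end Mixture

/-- **Lemma 2.1.** Let `F` be a distribution with finite mean `μ`, let `Y ∼ K` and let
`U` be uniform on `[0,1]` independent of `Y`. Set
`X = A(Y)·1_{U ≥ u(Y)} + B(Y)·1_{U < u(Y)}`. Then `F⁻¹(X) ∼ F`. -/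
theorem quantile_mixture_has_law_F
    (ν : Measure ℝ) [IsProbabilityMeasure ν] (μ : ℝ)
    (hint : Integrable id ν) (hμ : μ = ∫ x, x ∂ν)
    {Ω : Type*} [MeasurableSpace Ω] (P : Measure Ω) [IsProbabilityMeasure P]
    (Y U : Ω → ℝ) (hYm : Measurable Y) (hUm : Measurable U)
    (hYlaw : ∀ s : ℝ, (Measure.map Y P (Iic s)).toReal = Kfun ν μ s)
    (hUlaw : Measure.map U P = volume.restrict (Icc (0:ℝ) 1))
    (hindep : IndepFun U Y P) :
    Measure.map
      (fun ω => qf ν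
        (if U ω < ufun ν μ (Y ω) then Bfun ν μ (Y ω) else Afun ν μ (Y ω))) P = ν := by
  have hA := measurable_Afun (μ := μ) hint
  have hB := measurable_Bfun hint hμ
  have hu := measurable_ufun hint hμ
  set Ψ : ℝ × ℝ → ℝ := fun p =>
    qf ν (if p.1 < ufun ν μ p.2 then Bfun ν μ p.2 else Afun ν μ p.2)
  have hΨm : Measurable Ψ := (measurable_qf ν).comp
    (Measurable.ite (measurableSet_lt measurable_fst (hu.comp measurable_snd))
      (hB.comp measurable_snd) (hA.comp measurable_snd))
  have hjoint := hindep.map_prod_eq_prod_map_map hUm.aemeasurable hYm.aemeasurable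
  have := Measure.isProbabilityMeasure_map (μ := P) hYm.aemeasurable
  rw [hUlaw, map_Hfun_eq hint hμ hYlaw] at hjoint
  have hlaw : Measure.map (fun ω => Ψ (U ω, Y ω)) P =
      Measure.map Ψ ((volume.restrict (Icc 0 1)).prod
        (Measure.map (Hfun ν μ) (volume.restrict (Icc 0 1)))) := by
    rw [← hjoint, Measure.map_map hΨm (hUm.prodMk hYm)]
    rfl
  change Measure.map (fun ω => Ψ (U ω, Y ω)) P = ν
  refine Measure.ext_of_lintegral _ fun g hg => ?_
  have hT : Measurable fun y => ∫⁻ v in Icc (0 : ℝ) 1, g (Ψ (v, y)) :=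
    (hg.comp hΨm).lintegral_prod_left'
  rw [hlaw, lintegral_map hg hΨm,
    lintegral_prod_symm (fun p => g (Ψ p)) (hg.comp hΨm).aemeasurable,
    lintegral_map hT (continuous_Hfun hint).measurable,
    lintegral_mixture_Hfun hint hμ hg hT fun _ => rfl]
  conv_rhs => rw [← map_qf_restrict_Ioo ν]
  rw [lintegral_map hg (measurable_qf ν), restrict_Ioo_eq_restrict_Icc]
end

section
/- Let F be a cumulative distribution function on ℝ with mean μ and finite m-th absolute moment for some m > 1. Then there exist random variables X_i, i ∈ ℕ, each with distribution F, such that sup_{n∈ℕ} P(|S_n − nμ| > k) = o(k^{−(m−1)}) as k → ∞, where S_n = X₁ + ⋯ + X_n. In particular, for every ε > 0, P(|S_n − nμ| < n^ε) = 1 − o(n^{−(m−1)ε}) as n → ∞. -/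
open MeasureTheory ProbabilityTheory Set Filter Topology Asymptotics

/-- If `R` has a finite `p`-th moment, then `P (k ≤ R) = o(k ^ (-p))`. -/
lemma isLittleO_measureReal_le_of_integrable_rpow {Ω : Type*} [MeasurableSpace Ω]
    {P : Measure Ω} [IsFiniteMeasure P] {R : Ω → ℝ} {p : ℝ} (hR : Measurable R)
    (hp : 0 ≤ p) (hint : Integrable (fun ω => |R ω| ^ p) P) :
    (fun k : ℝ => P.real {ω | k ≤ R ω}) =o[atTop] fun k : ℝ => k ^ (-p) := by
  have hlim : Tendsto (fun k : ℝ => ∫ ω, {ω | k ≤ R ω}.indicator (fun ω => |R ω| ^ p) ω ∂P)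
      atTop (𝓝 (∫ _, (0 : ℝ) ∂P)) := by
    refine tendsto_integral_filter_of_dominated_convergence (fun ω => |R ω| ^ p)
      (Eventually.of_forall fun k => ?_) (Eventually.of_forall fun k => ?_) hint ?_
    · exact hint.aestronglyMeasurable.indicator (measurableSet_le measurable_const hR)
    · refine Eventually.of_forall fun ω => ?_
      refine (norm_indicator_le_norm_self _ _).trans_eq ?_
      rw [Real.norm_of_nonneg (by positivity)]
    · refine Eventually.of_forall fun ω => tendsto_const_nhds.congr' ?_
      filter_upwards [eventually_gt_atTop (R ω)] with k hk
      rw [indicator_of_notMem]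
      simpa using hk
  rw [integral_zero] at hlim
  rw [isLittleO_iff]
  intro c hc
  filter_upwards [eventually_gt_atTop 0, hlim.eventually_lt_const hc] with k hk hkc
  have hms : MeasurableSet {ω | k ≤ R ω} := measurableSet_le measurable_const hR
  have hmarkov : k ^ p * P.real {ω | k ≤ R ω} ≤ c := by
    refine le_trans ?_ hkc.le
    rw [integral_indicator hms, mul_comm, ← smul_eq_mul, ← setIntegral_const]
    refine setIntegral_mono_on (integrable_const _).integrableOn hint.integrableOn hms ?_
    intro ω hω
    exact Real.rpow_le_rpow hk.le (le_trans hω (le_abs_self _)) hp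
  have hkp : 0 < k ^ p := Real.rpow_pos_of_pos hk p
  rw [Real.norm_of_nonneg measureReal_nonneg, Real.norm_of_nonneg (by positivity),
    Real.rpow_neg hk.le, ← div_eq_mul_inv, le_div_iff₀ hkp]
  linarith

/-- A family of random variables dominated by a single `R` with finite `p`-th moment has
uniformly small tails. -/
lemma isLittleO_tails_of_dominated {Ω : Type*} [MeasurableSpace Ω]
    {P : Measure Ω} [IsProbabilityMeasure P] {D : ℕ → Ω → ℝ} {R : Ω → ℝ} {p : ℝ}
    (hR : Measurable R) (hp : 0 ≤ p) (hint : Integrable (fun ω => |R ω| ^ p) P)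
    (hD : ∀ n, ∀ᵐ ω ∂P, |D n ω| ≤ R ω) :
    ((fun k : ℝ => ⨆ n : ℕ, (P {ω | k < |D n ω|}).toReal) =o[atTop] fun k : ℝ => k ^ (-p)) ∧
      ∀ ε : ℝ, 0 < ε →
        ((fun n : ℕ => 1 - (P {ω | |D n ω| < (n : ℝ) ^ ε}).toReal)
          =o[atTop] fun n : ℕ => (n : ℝ) ^ (-p * ε)) := by
  have htail := isLittleO_measureReal_le_of_integrable_rpow hR hp hint
  have hle : ∀ n k, P.real {ω | k ≤ |D n ω|} ≤ P.real {ω | k ≤ R ω} := fun n k =>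
    ENNReal.toReal_mono (measure_ne_top _ _) <| measure_mono_ae <| by
      filter_upwards [hD n] with ω hω h
      exact le_trans h hω
  constructor
  · refine IsBigO.trans_isLittleO (IsBigO.of_bound 1 (Eventually.of_forall fun k => ?_)) htail
    rw [Real.norm_of_nonneg (Real.iSup_nonneg fun n => ENNReal.toReal_nonneg), one_mul,
      Real.norm_of_nonneg measureReal_nonneg]
    refine ciSup_le fun n => le_trans ?_ (hle n k)
    exact measureReal_mono fun ω (h : k < |D n ω|) => h.le
  · intro ε hε
    have hcomp := htail.comp_tendsto
      ((tendsto_rpow_atTop hε).comp (tendsto_natCast_atTop_atTop (R := ℝ)))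
    have hpow : ((fun k : ℝ => k ^ (-p)) ∘ ((fun x : ℝ => x ^ ε) ∘ ((↑) : ℕ → ℝ)))
        = fun n : ℕ => (n : ℝ) ^ (-p * ε) := by
      funext n
      simp only [Function.comp_apply]
      rw [← Real.rpow_mul n.cast_nonneg, mul_comm]
    rw [hpow] at hcomp
    refine IsBigO.trans_isLittleO (IsBigO.of_bound 1 (Eventually.of_forall fun n => ?_)) hcomp
    simp only [Function.comp_apply]
    have h1 : P.real {ω | |D n ω| < (n : ℝ) ^ ε} ≤ 1 := measureReal_le_one
    have h2 : 1 ≤ P.real {ω | |D n ω| < (n : ℝ) ^ ε} + P.real {ω | (n : ℝ) ^ ε ≤ |D n ω|} := by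
      refine le_trans (le_of_eq ?_) (measureReal_union_le _ _)
      rw [← probReal_univ (μ := P)]
      congr 1
      ext ω
      simp [lt_or_ge]
    change ‖1 - P.real _‖ ≤ _
    rw [Real.norm_of_nonneg (by linarith), one_mul, Real.norm_of_nonneg measureReal_nonneg]
    linarith [hle n ((n : ℝ) ^ ε)]

lemma integral_floor_add_sub_floor (u v : ℝ) :
    ∫ t in (0 : ℝ)..1, ((⌊t + (v + u)⌋ : ℝ) - ⌊t + v⌋) = u := by
  have hper : Function.Periodic (Int.fract : ℝ → ℝ) 1 := fun x => by simp
  have hii : ∀ a b : ℝ, IntervalIntegrable (Int.fract : ℝ → ℝ) volume a b := fun a b => by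
    refine (intervalIntegrable_const (c := (1 : ℝ))).mono_fun
      measurable_fract.aestronglyMeasurable (Eventually.of_forall fun x => ?_)
    simpa [abs_of_nonneg (Int.fract_nonneg x)] using (Int.fract_lt_one x).le
  have hshift : ∀ w : ℝ, ∫ t in (0 : ℝ)..1, Int.fract (t + w) = ∫ t in (0 : ℝ)..1, Int.fract t := by
    intro w
    rw [intervalIntegral.integral_comp_add_right (fun t : ℝ => Int.fract t), zero_add, add_comm 1 w,
      hper.intervalIntegral_add_eq w 0, zero_add]
  have hiis : ∀ w : ℝ, IntervalIntegrable (fun t : ℝ => Int.fract (t + w)) volume 0 1 := fun w => by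
    simpa using (hii w (1 + w)).comp_add_right w
  have hfun : (fun t : ℝ => (⌊t + (v + u)⌋ : ℝ) - ⌊t + v⌋)
      = fun t => u - (Int.fract (t + (v + u)) - Int.fract (t + v)) := by
    funext t
    rw [Int.fract, Int.fract]
    ring
  rw [hfun, intervalIntegral.integral_sub intervalIntegrable_const ((hiis _).sub (hiis _)),
    intervalIntegral.integral_sub (hiis _) (hiis _), hshift, hshift]
  simp

lemma floor_add_sub_floor_eq_zero_or_one {u : ℝ} (h0 : 0 ≤ u) (h1 : u < 1) (x : ℝ) :
    ⌊x + u⌋ - ⌊x⌋ = 0 ∨ ⌊x + u⌋ - ⌊x⌋ = 1 := by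
  have hl : ⌊x⌋ ≤ ⌊x + u⌋ := Int.floor_mono (by linarith)
  have hu : ⌊x + u⌋ ≤ ⌊x + 1⌋ := Int.floor_mono (by linarith)
  rw [Int.floor_add_one] at hu
  omega

/-- For `t` uniform on `(0, 1]`, the floor increment `⌊t + v + u⌋ - ⌊t + v⌋` is Bernoulli with
parameter `u`. -/
lemma lintegral_comp_floor_add_sub_floor {u : ℝ} (h0 : 0 ≤ u) (h1 : u < 1) (v : ℝ)
    (f : ℝ → ENNReal) :
    ∫⁻ t in Ioc (0 : ℝ) 1, f ((⌊t + (v + u)⌋ : ℝ) - ⌊t + v⌋)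
      = ENNReal.ofReal (1 - u) * f 0 + ENNReal.ofReal u * f 1 := by
  set J : ℝ → ℝ := fun t => (⌊t + (v + u)⌋ : ℝ) - ⌊t + v⌋ with hJ
  have hJm : Measurable J := by
    refine Measurable.sub ?_ ?_
    · exact measurable_from_top.comp (Int.measurable_floor.comp (measurable_id.add_const (v + u)))
    · exact measurable_from_top.comp (Int.measurable_floor.comp (measurable_id.add_const v))
  have hJ01 : ∀ t, J t = 0 ∨ J t = 1 := by
    intro t
    have h := floor_add_sub_floor_eq_zero_or_one h0 h1 (t + v)
    simp only [hJ, ← add_assoc]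
    exact_mod_cast h
  have hJint : ∫ t in Ioc (0 : ℝ) 1, J t = u := by
    rw [← intervalIntegral.integral_of_le zero_le_one]
    exact integral_floor_add_sub_floor u v
  have hJi : Integrable J (volume.restrict (Ioc (0 : ℝ) 1)) := by
    refine (integrable_const (1 : ℝ)).mono hJm.aestronglyMeasurable
      (Eventually.of_forall fun t => ?_)
    rcases hJ01 t with h | h <;> simp [h]
  have hone : ∫⁻ t in Ioc (0 : ℝ) 1, ENNReal.ofReal (J t) = ENNReal.ofReal u := by
    rw [← ofReal_integral_eq_lintegral_ofReal hJi, hJint]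
    refine Eventually.of_forall fun t => ?_
    rcases hJ01 t with h | h <;> simp [h]
  have hzero : ∫⁻ t in Ioc (0 : ℝ) 1, ENNReal.ofReal (1 - J t) = ENNReal.ofReal (1 - u) := by
    rw [← ofReal_integral_eq_lintegral_ofReal (f := fun t => 1 - J t)
      ((integrable_const 1).sub hJi), integral_sub (integrable_const _) hJi, hJint]
    · simp
    refine Eventually.of_forall fun t => ?_
    rcases hJ01 t with h | h <;> simp [h]
  have hsplit : ∀ t, f (J t) = ENNReal.ofReal (1 - J t) * f 0 + ENNReal.ofReal (J t) * f 1 := by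
    intro t
    rcases hJ01 t with h | h <;> simp [h]
  change ∫⁻ t in Ioc (0 : ℝ) 1, f (J t) = _
  simp_rw [hsplit]
  rw [lintegral_add_left (by fun_prop), lintegral_mul_const _ (by fun_prop),
    lintegral_mul_const _ (by fun_prop), hzero, hone]

/-- The first moments of `ν` above and below its mean coincide. -/
lemma lintegral_Iic_eq_lintegral_Ioi_of_eq_integral {ν : Measure ℝ} [IsProbabilityMeasure ν]
    {μ : ℝ} (hint : Integrable (fun x : ℝ => x) ν) (hμ : μ = ∫ x, x ∂ν) :
    ∫⁻ x in Iic μ, ENNReal.ofReal (μ - x) ∂ν = ∫⁻ x in Ioi μ, ENNReal.ofReal (x - μ) ∂ν := by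
  have hsub : Integrable (fun x => x - μ) ν := hint.sub (integrable_const _)
  have hsub' : Integrable (fun x => μ - x) ν := (integrable_const _).sub hint
  have hsum : ∫ x in Iic μ, (x - μ) ∂ν + ∫ x in Ioi μ, (x - μ) ∂ν = 0 := by
    rw [← compl_Iic, integral_add_compl measurableSet_Iic hsub,
      integral_sub hint (integrable_const _), ← hμ]
    simp
  rw [← ofReal_integral_eq_lintegral_ofReal hsub'.integrableOn,
    ← ofReal_integral_eq_lintegral_ofReal hsub.integrableOn]
  · congr 1
    have hneg : ∫ x in Iic μ, (μ - x) ∂ν = -∫ x in Iic μ, (x - μ) ∂ν := by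
      rw [← integral_neg]
      simp
    linarith
  · filter_upwards [ae_restrict_mem measurableSet_Ioi] with x hx
    exact sub_nonneg.2 (le_of_lt hx)
  · filter_upwards [ae_restrict_mem measurableSet_Iic] with x hx
    exact sub_nonneg.2 hx

/-- The law of a pair `(a, b)` with `a ≤ μ < b`, with density proportional to `b - a` with respect
to `ν ⊗ ν`. It exhibits `ν` as a mixture of two-point distributions with mean `μ`. -/
noncomputable def twoPointPairLaw (ν : Measure ℝ) (μ : ℝ) : Measure (ℝ × ℝ) :=
  ((ν.restrict (Iic μ)).prod (ν.restrict (Ioi μ))).withDensity fun q =>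
    (∫⁻ x in Ioi μ, ENNReal.ofReal (x - μ) ∂ν)⁻¹ * ENNReal.ofReal (q.2 - q.1)

/-- The probability that the two-point distribution on `{a, b}` with mean `μ` gives to `b`. -/
noncomputable def upperWeight (μ : ℝ) (q : ℝ × ℝ) : ℝ := (μ - q.1) / (q.2 - q.1)

/-- A sequence with values in `{a, b}` driven by the rotation of the circle with angle
`upperWeight μ (a, b)`. -/
noncomputable def rotationSeq (μ : ℝ) (i : ℕ) (ω : (ℝ × ℝ) × ℝ) : ℝ :=
  ω.1.1 + (ω.1.2 - ω.1.1) *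
    ((⌊ω.2 + (i * upperWeight μ ω.1 + upperWeight μ ω.1)⌋ : ℝ) - ⌊ω.2 + i * upperWeight μ ω.1⌋)

lemma measurable_upperWeight (μ : ℝ) : Measurable (upperWeight μ) := by
  unfold upperWeight
  fun_prop

lemma measurable_rotationSeq (μ : ℝ) (i : ℕ) : Measurable (rotationSeq μ i) := by
  have hu : Measurable fun ω : (ℝ × ℝ) × ℝ => upperWeight μ ω.1 :=
    (measurable_upperWeight μ).comp measurable_fst
  have hfloor : ∀ g : (ℝ × ℝ) × ℝ → ℝ, Measurable g → Measurable fun ω => (⌊g ω⌋ : ℝ) :=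
    fun g hg => measurable_from_top.comp (Int.measurable_floor.comp hg)
  have h1 := hfloor _ (measurable_snd.add ((hu.const_mul (i : ℝ)).add hu))
  have h2 := hfloor _ (measurable_snd.add (hu.const_mul (i : ℝ)))
  unfold rotationSeq
  exact (by fun_prop : Measurable fun ω : (ℝ × ℝ) × ℝ => ω.1.1).add
    ((by fun_prop : Measurable fun ω : (ℝ × ℝ) × ℝ => ω.1.2 - ω.1.1).mul (h1.sub h2))

lemma abs_sum_rotationSeq_sub_le {μ : ℝ} {ω : (ℝ × ℝ) × ℝ} (h : ω.1.1 < ω.1.2) (n : ℕ) :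
    |(∑ i ∈ Finset.range n, rotationSeq μ i ω) - n * μ| ≤ ω.1.2 - ω.1.1 := by
  have hpos : 0 < ω.1.2 - ω.1.1 := sub_pos.2 h
  set u := upperWeight μ ω.1 with hu
  have hmul : (ω.1.2 - ω.1.1) * u = μ - ω.1.1 := by
    rw [hu, upperWeight]
    field_simp
  have hsum : ∑ i ∈ Finset.range n, rotationSeq μ i ω
      = n * ω.1.1 + (ω.1.2 - ω.1.1) * ((⌊ω.2 + n * u⌋ : ℝ) - ⌊ω.2⌋) := by
    have htel := Finset.sum_range_sub (fun i : ℕ => (⌊ω.2 + i * u⌋ : ℝ)) n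
    simp only [Nat.cast_zero, zero_mul, add_zero] at htel
    rw [← htel, Finset.mul_sum, ← nsmul_eq_mul, ← Finset.card_range n, ← Finset.sum_const,
      Finset.card_range, ← Finset.sum_add_distrib]
    refine Finset.sum_congr rfl fun i _ => ?_
    rw [rotationSeq, ← hu]
    push_cast
    rw [add_mul, one_mul]
  have hdiff : (∑ i ∈ Finset.range n, rotationSeq μ i ω) - n * μ
      = (ω.1.2 - ω.1.1) * (Int.fract ω.2 - Int.fract (ω.2 + n * u)) := by
    rw [hsum, Int.fract, Int.fract]
    linear_combination (n : ℝ) * hmul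
  rw [hdiff, abs_mul, abs_of_pos hpos]
  refine mul_le_of_le_one_right hpos.le (abs_le.2 ⟨?_, ?_⟩) <;>
  linarith [Int.fract_nonneg ω.2, Int.fract_lt_one ω.2, Int.fract_nonneg (ω.2 + n * u),
    Int.fract_lt_one (ω.2 + n * u)]

lemma ae_twoPointPairLaw (ν : Measure ℝ) [IsProbabilityMeasure ν] (μ : ℝ) :
    ∀ᵐ q ∂(twoPointPairLaw ν μ), q.1 ≤ μ ∧ μ < q.2 := by
  refine (withDensity_absolutelyContinuous _ _).ae_le ?_
  rw [Measure.prod_restrict]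
  filter_upwards [ae_restrict_mem (measurableSet_Iic.prod measurableSet_Ioi)] with q hq
  exact hq

lemma lintegral_twoPointPairLaw (ν : Measure ℝ) [IsProbabilityMeasure ν] (μ : ℝ)
    {g : ℝ × ℝ → ENNReal} (hg : Measurable g) :
    ∫⁻ q, g q ∂(twoPointPairLaw ν μ) = (∫⁻ x in Ioi μ, ENNReal.ofReal (x - μ) ∂ν)⁻¹ *
      ∫⁻ q, ENNReal.ofReal (q.2 - q.1) * g q
        ∂((ν.restrict (Iic μ)).prod (ν.restrict (Ioi μ))) := by
  rw [twoPointPairLaw, lintegral_withDensity_eq_lintegral_mul _ (by fun_prop) hg,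
    ← lintegral_const_mul _ (by fun_prop)]
  simp [mul_assoc]

instance (ν : Measure ℝ) [IsProbabilityMeasure ν] (μ : ℝ) : SFinite (twoPointPairLaw ν μ) := by
  unfold twoPointPairLaw
  infer_instance

lemma map_rotationSeq {ν : Measure ℝ} [IsProbabilityMeasure ν] {μ : ℝ}
    (hint : Integrable (fun x : ℝ => x) ν) (hμ : μ = ∫ x, x ∂ν)
    (hc : ∫⁻ x in Ioi μ, ENNReal.ofReal (x - μ) ∂ν ≠ 0) (i : ℕ) :
    Measure.map (rotationSeq μ i) ((twoPointPairLaw ν μ).prod (volume.restrict (Ioc (0 : ℝ) 1)))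
      = ν := by
  have hbal := lintegral_Iic_eq_lintegral_Ioi_of_eq_integral hint hμ
  have hctop : ∫⁻ x in Ioi μ, ENNReal.ofReal (x - μ) ∂ν ≠ ⊤ :=
    (hint.sub (integrable_const μ)).integrableOn.lintegral_lt_top.ne
  have hlin := fun g hg => lintegral_twoPointPairLaw (g := g) ν μ hg
  set c := ∫⁻ x in Ioi μ, ENNReal.ofReal (x - μ) ∂ν with hcdef
  ext s hs
  set f : ℝ → ENNReal := s.indicator 1 with hf
  have hfm : Measurable f := measurable_one.indicator hs
  have hXm := measurable_rotationSeq μ i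
  have hfX : Measurable fun ω => f (rotationSeq μ i ω) := hfm.comp hXm
  rw [← lintegral_indicator_one hs, lintegral_map hfm hXm,
    lintegral_prod _ hfX.aemeasurable, hlin _ hfX.lintegral_prod_right']
  have hae : ∀ᵐ q ∂((ν.restrict (Iic μ)).prod (ν.restrict (Ioi μ))),
      ENNReal.ofReal (q.2 - q.1) * (∫⁻ t in Ioc (0 : ℝ) 1, f (rotationSeq μ i (q, t)))
        = f q.1 * ENNReal.ofReal (q.2 - μ) + ENNReal.ofReal (μ - q.1) * f q.2 := by
    rw [Measure.prod_restrict]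
    filter_upwards [ae_restrict_mem (measurableSet_Iic.prod measurableSet_Ioi)] with q hq
    have ha : q.1 ≤ μ := hq.1
    have hb : μ < q.2 := hq.2
    have hpos : 0 < q.2 - q.1 := by linarith
    have h0 : 0 ≤ upperWeight μ q := div_nonneg (by linarith) hpos.le
    have h1 : upperWeight μ q < 1 := (div_lt_one hpos).2 (by linarith)
    have hber := lintegral_comp_floor_add_sub_floor h0 h1 (i * upperWeight μ q)
      (fun x => f (q.1 + (q.2 - q.1) * x))
    simp only [rotationSeq]
    rw [hber, mul_add, ← mul_assoc, ← mul_assoc, ← ENNReal.ofReal_mul hpos.le,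
      ← ENNReal.ofReal_mul hpos.le]
    have e1 : (q.2 - q.1) * (1 - upperWeight μ q) = q.2 - μ := by
      rw [upperWeight]
      field_simp
      ring
    have e2 : (q.2 - q.1) * upperWeight μ q = μ - q.1 := by
      rw [upperWeight]
      field_simp
    rw [e1, e2, mul_comm (f q.1)]
    simp
  rw [lintegral_congr_ae hae, lintegral_add_left (by fun_prop),
    lintegral_prod_mul (f := f) (g := fun b => ENNReal.ofReal (b - μ)) (by fun_prop) (by fun_prop),
    lintegral_prod_mul (f := fun a => ENNReal.ofReal (μ - a)) (g := f) (by fun_prop) (by fun_prop),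
    hbal, ← hcdef, mul_comm _ c, ← mul_add, ← mul_assoc, ENNReal.inv_mul_cancel hc hctop, one_mul,
    ← compl_Iic, lintegral_add_compl _ measurableSet_Iic, hf,
    lintegral_indicator_one hs]

lemma memLp_of_integrable_abs_rpow {ν : Measure ℝ} {m : ℝ} (hm : 0 < m)
    (hmom : Integrable (fun x : ℝ => |x| ^ m) ν) :
    MemLp (fun x : ℝ => x) (ENNReal.ofReal m) ν := by
  rw [← integrable_norm_rpow_iff (f := fun x : ℝ => x) measurable_id.aestronglyMeasurable
    (by simpa using hm) ENNReal.ofReal_ne_top, ENNReal.toReal_ofReal hm.le]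
  exact hmom

lemma integrable_rpow_twoPointPairLaw {ν : Measure ℝ} [IsProbabilityMeasure ν] {μ m : ℝ}
    (hm : 1 < m) (hmom : Integrable (fun x : ℝ => |x| ^ m) ν)
    (hc : ∫⁻ x in Ioi μ, ENNReal.ofReal (x - μ) ∂ν ≠ 0) :
    Integrable (fun q : ℝ × ℝ => |q.2 - q.1| ^ (m - 1)) (twoPointPairLaw ν μ) := by
  have hm0 : ENNReal.ofReal m ≠ 0 := by simpa using by linarith
  have hmR : (ENNReal.ofReal m).toReal = m := ENNReal.toReal_ofReal (by linarith)
  have hmem : ∀ s : Set ℝ, MemLp (fun x : ℝ => x) (ENNReal.ofReal m) (ν.restrict s) :=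
    fun s => (memLp_of_integrable_abs_rpow (by linarith) hmom).restrict s
  have hdiff : MemLp (fun q : ℝ × ℝ => q.2 - q.1) (ENNReal.ofReal m)
      ((ν.restrict (Iic μ)).prod (ν.restrict (Ioi μ))) :=
    ((hmem (Ioi μ)).comp_snd _).sub ((hmem (Iic μ)).comp_fst _)
  have hpow := hdiff.integrable_norm_rpow hm0 ENNReal.ofReal_ne_top
  rw [hmR] at hpow
  have hmeas : Measurable fun q : ℝ × ℝ => |q.2 - q.1| ^ (m - 1) := by fun_prop
  refine ⟨hmeas.aestronglyMeasurable, ?_⟩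
  rw [hasFiniteIntegral_iff_ofReal (Eventually.of_forall fun q => by positivity),
    lintegral_twoPointPairLaw ν μ (by fun_prop)]
  refine ENNReal.mul_lt_top (ENNReal.inv_lt_top.2 (pos_iff_ne_zero.2 hc)) ?_
  refine lt_of_le_of_lt (lintegral_mono fun q => ?_) hpow.lintegral_lt_top
  rw [← ENNReal.ofReal_mul' (by positivity)]
  refine ENNReal.ofReal_le_ofReal ?_
  rw [Real.norm_eq_abs]
  rcases eq_or_ne (q.2 - q.1) 0 with h | h
  · rw [h, zero_mul]
    positivity
  · rw [Real.rpow_sub_one (abs_ne_zero.2 h)]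
    have habs : 0 < |q.2 - q.1| := abs_pos.2 h
    calc (q.2 - q.1) * (|q.2 - q.1| ^ m / |q.2 - q.1|)
        ≤ |q.2 - q.1| * (|q.2 - q.1| ^ m / |q.2 - q.1|) := by
          gcongr
          exact le_abs_self _
      _ = |q.2 - q.1| ^ m := by field_simp

lemma ae_eq_of_lintegral_Ioi_eq_zero {ν : Measure ℝ} [IsProbabilityMeasure ν] {μ : ℝ}
    (hint : Integrable (fun x : ℝ => x) ν) (hμ : μ = ∫ x, x ∂ν)
    (hc : ∫⁻ x in Ioi μ, ENNReal.ofReal (x - μ) ∂ν = 0) : ∀ᵐ x ∂ν, x = μ := by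
  have hbal := lintegral_Iic_eq_lintegral_Ioi_of_eq_integral hint hμ
  rw [hc, lintegral_eq_zero_iff (by fun_prop), EventuallyEq,
    ae_restrict_iff' measurableSet_Iic] at hbal
  rw [lintegral_eq_zero_iff (by fun_prop), EventuallyEq, ae_restrict_iff' measurableSet_Ioi] at hc
  filter_upwards [hbal, hc] with x h1 h2
  rcases le_or_gt x μ with h | h
  · have h3 := h1 h
    simp at h3
    exact le_antisymm h h3
  · have h3 := h2 h
    simp at h3
    exact absurd h (not_lt.2 h3)

/-- **Proposition 2.1.** If `F` has mean `μ` and finite `m`-th absolute moment, `m > 1`,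
then there exist random variables `X₁, X₂, …` each distributed as `F` such that,
uniformly in `n`, `P(|S_n − nμ| > k) = o(k^{−(m−1)})` as `k → ∞`; in particular, for
every `ε > 0`, `P(|S_n − nμ| < n^ε) = 1 − o(n^{−(m−1)ε})` as `n → ∞`. -/
theorem tail_bound_uniform_in_n
    (ν : Measure ℝ) [IsProbabilityMeasure ν] (μ : ℝ) (m : ℝ) (hm : 1 < m)
    (hmom : Integrable (fun x : ℝ => |x| ^ m) ν) (hμ : μ = ∫ x, x ∂ν) :
    ∃ (Ω : Type) (mΩ : MeasurableSpace Ω) (P : Measure Ω) (X : ℕ → Ω → ℝ),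
      IsProbabilityMeasure P ∧
      (∀ i, Measure.map (X i) P = ν) ∧
      ((fun k : ℝ =>
          ⨆ n : ℕ, (P {ω | k < |(∑ i ∈ Finset.range n, X i ω) - (n : ℝ) * μ|}).toReal)
        =o[atTop] fun k : ℝ => k ^ (-(m - 1))) ∧
      ∀ ε : ℝ, 0 < ε →
        ((fun n : ℕ =>
            1 - (P {ω | |(∑ i ∈ Finset.range n, X i ω) - (n : ℝ) * μ| < (n : ℝ) ^ ε}).toReal)
          =o[atTop] fun n : ℕ => (n : ℝ) ^ (-(m - 1) * ε)) := by
  have hint : Integrable (fun x : ℝ => x) ν := by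
    rw [← memLp_one_iff_integrable]
    exact (memLp_of_integrable_abs_rpow (by linarith) hmom).mono_exponent (by simpa using hm.le)
  have hp : 0 ≤ m - 1 := by linarith
  by_cases hc : ∫⁻ x in Ioi μ, ENNReal.ofReal (x - μ) ∂ν = 0
  · refine ⟨ℝ, inferInstance, ν, fun _ x => x, inferInstance, fun _ => Measure.map_id, ?_⟩
    refine isLittleO_tails_of_dominated (R := fun _ => 0) measurable_const hp
      (integrable_const _) fun n => ?_
    filter_upwards [ae_eq_of_lintegral_Ioi_eq_zero hint hμ hc] with x hx
    simp [hx]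
  · set P := (twoPointPairLaw ν μ).prod (volume.restrict (Ioc (0 : ℝ) 1))
    have hmap : ∀ i, Measure.map (rotationSeq μ i) P = ν := map_rotationSeq hint hμ hc
    have hprob : IsProbabilityMeasure P := by
      constructor
      rw [← preimage_univ (f := rotationSeq μ 0),
        ← Measure.map_apply (measurable_rotationSeq μ 0) MeasurableSet.univ, hmap, measure_univ]
    refine ⟨(ℝ × ℝ) × ℝ, inferInstance, P, rotationSeq μ, hprob, hmap, ?_⟩
    refine isLittleO_tails_of_dominated (R := fun ω => ω.1.2 - ω.1.1) (by fun_prop) hp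
      ((integrable_rpow_twoPointPairLaw hm hmom hc).comp_fst _) fun n => ?_
    filter_upwards [Measure.quasiMeasurePreserving_fst.ae (ae_twoPointPairLaw ν μ)] with ω hω
    exact abs_sum_rotationSeq_sub_le (hω.1.trans_lt hω.2) n
end
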